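/- Let H be a subgroup of a finite group G with |G| > 1 and let 1 denote the trivial representation of G. Let J^r_1(ρ) denote the r-step probability of the chain J (with kernel J(ρ,σ) = (|H|/|G|)·(dim σ/dim ρ)·Σ_τ κ(τ,ρ)κ(τ,σ)) started at the trivial representation. Then J^r_1(ρ) = dim(ρ)·(|H|/|G|)^r·⟨χ^ρ, (Ind_H^G 1)^r⟩, the normalized multiplicity of ρ in the r-th tensor power of Ind_H^G(1). -/

import Mathlib

open FDRep Module CategoryTheory
open scoped Classical

/-- `κ(τ,ρ)`: the multiplicity of the irreducible `τ` of `H` in the restriction of `ρ`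
from `G` to `H`. -/
noncomputable def kappa {G : Type} [Group G] (H : Subgroup G) [Fintype H]
    (τ : FDRep ℂ H) (ρ : FDRep ℂ G) : ℂ :=
  (Fintype.card H : ℂ)⁻¹ *
    ∑ h : H, (starRingEnd ℂ) (τ.character h) * ρ.character (h : G)

open scoped ComplexConjugate ComplexOrder

/-- The Hermitian form averaged over a finite group is invariant, so complex conjugation of a
character amounts to inversion in the group. -/
theorem FDRep.conj_character {K : Type} [Group K] [Fintype K] (V : FDRep ℂ K) (g : K) :
    conj (V.character g) = V.character g⁻¹ := by
  let b := Module.finBasis ℂ V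
  let A : K → Matrix _ _ ℂ := fun g => LinearMap.toMatrix b b (V.ρ g)
  have hmul : ∀ x y, A (x * y) = A x * A y := fun x y => by
    simp only [A, map_mul, Module.End.mul_eq_comp]
    exact LinearMap.toMatrix_comp b b b _ _
  have hone : A 1 = 1 := by
    simp only [A, map_one]
    exact LinearMap.toMatrix_one b
  have htr : ∀ x, V.character x = (A x).trace := fun x =>
    LinearMap.trace_eq_matrix_trace ℂ b (V.ρ x)
  let P := ∑ x, (A x).conjTranspose * A x
  have hP : P.PosDef := by
    have : P = (A 1).conjTranspose * A 1 +
        ∑ x ∈ Finset.univ.erase 1, (A x).conjTranspose * A x :=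
      (Finset.add_sum_erase _ _ (Finset.mem_univ 1)).symm
    rw [this, hone, Matrix.conjTranspose_one, one_mul]
    exact Matrix.PosDef.one.add_posSemidef
      (Matrix.posSemidef_sum _ fun x _ => Matrix.posSemidef_conjTranspose_mul_self _)
  have hinv : (A g).conjTranspose * P = P * A g⁻¹ := by
    have h1 : (A g).conjTranspose * P * A g = P := by
      simp only [P, Finset.mul_sum, Finset.sum_mul]
      rw [← Equiv.sum_comp (Equiv.mulRight g) fun x => (A x).conjTranspose * A x]
      refine Finset.sum_congr rfl fun x _ => ?_
      simp only [Equiv.coe_mulRight, hmul, Matrix.conjTranspose_mul, Matrix.mul_assoc]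
    calc (A g).conjTranspose * P = (A g).conjTranspose * P * (A g * A g⁻¹) := by
          rw [← hmul, mul_inv_cancel, hone, mul_one]
      _ = P * A g⁻¹ := by rw [← mul_assoc, h1]
  have hdet : IsUnit P.det := (Matrix.isUnit_iff_isUnit_det P).1 hP.isUnit
  have : (A g).conjTranspose = P * A g⁻¹ * P⁻¹ := by
    rw [← hinv, Matrix.mul_nonsing_inv_cancel_right _ _ hdet]
  rw [htr, htr, starRingEnd_apply, ← Matrix.trace_conjTranspose, this, Matrix.trace_mul_comm,
    Matrix.nonsing_inv_mul_cancel_left _ _ hdet]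

/-- The character of an object split into two retracts. -/
theorem FDRep.character_eq_add_of_splitting {K : Type} [Group K] {V W U : FDRep ℂ K}
    (i : W ⟶ V) (p : V ⟶ W) (j : U ⟶ V) (q : V ⟶ U)
    (hip : i ≫ p = 𝟙 W) (hjq : j ≫ q = 𝟙 U) (h : p ≫ i + q ≫ j = 𝟙 V) (g : K) :
    V.character g = W.character g + U.character g := by
  have key : ∀ {W : FDRep ℂ K} (i : W ⟶ V) (p : V ⟶ W), i ≫ p = 𝟙 W →
      LinearMap.trace ℂ V (V.ρ g ∘ₗ (p ≫ i).hom.hom.hom) = W.character g := by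
    intro W i p hip
    have hc : V.ρ g ∘ₗ i.hom.hom.hom = i.hom.hom.hom ∘ₗ W.ρ g := by
      have := congrArg (fun f => f.hom.hom) (i.comm g)
      exact this.symm
    have hid : p.hom.hom.hom ∘ₗ i.hom.hom.hom = LinearMap.id :=
      congrArg (fun f => f.hom.hom.hom) hip
    change LinearMap.trace ℂ V (V.ρ g ∘ₗ (i.hom.hom.hom ∘ₗ p.hom.hom.hom)) =
      LinearMap.trace ℂ W (W.ρ g)
    rw [← LinearMap.comp_assoc, hc, LinearMap.comp_assoc, LinearMap.trace_comp_comm',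
      LinearMap.comp_assoc, hid, LinearMap.comp_id]
  have hid : (p ≫ i).hom.hom.hom + (q ≫ j).hom.hom.hom = LinearMap.id :=
    congrArg (fun f => f.hom.hom.hom) h
  rw [← key i p hip, ← key j q hjq, ← map_add, ← LinearMap.comp_add, hid, LinearMap.comp_id]
  rfl

theorem FDRep.exists_character_eq_sum {K ι : Type} [Group K] [Fintype K] [Fintype ι]
    (Irr : ι → FDRep ℂ K)
    (hcomplete : ∀ V : FDRep ℂ K, Simple V → ∃ i, Nonempty (V ≅ Irr i)) (V : FDRep ℂ K) :
    ∃ c : ι → ℂ, ∀ g, V.character g = ∑ i, c i * (Irr i).character g := by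
  induction hn : finrank ℂ V using Nat.strong_induction_on generalizing V with
  | _ n ih =>
    subst hn
    by_cases hV : Simple V
    · obtain ⟨i, ⟨e⟩⟩ := hcomplete V hV
      exact ⟨fun j => if j = i then 1 else 0, fun g => by simp [FDRep.char_iso e]⟩
    by_cases h0 : 𝟙 V = 0
    · refine ⟨0, fun g => ?_⟩
      have hid : (LinearMap.id : V →ₗ[ℂ] V) = 0 := congrArg (fun f => f.hom.hom.hom) h0
      have : V.ρ g = 0 := by rw [← LinearMap.comp_id (V.ρ g), hid, LinearMap.comp_zero]
      simp [FDRep.character, this]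
    obtain ⟨W, f, hf, hf0, hfi⟩ : ∃ (W : FDRep ℂ K) (f : W ⟶ V), Mono f ∧ f ≠ 0 ∧ ¬ IsIso f := by
      by_contra! hcon
      refine hV ⟨fun {W} f hf => ⟨fun hi hz => h0 ?_, hcon W f hf⟩⟩
      rw [← cancel_epi f, hz, Limits.zero_comp, Limits.comp_zero]
    let r : V ⟶ W := Injective.factorThru (𝟙 W) f
    have hr : f ≫ r = 𝟙 W := Injective.comp_factorThru _ _
    let q : V ⟶ Limits.kernel r := Limits.kernel.lift r (𝟙 V - r ≫ f) (by simp [hr])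
    have hq : q ≫ Limits.kernel.ι r = 𝟙 V - r ≫ f := Limits.kernel.lift_ι _ _ _
    have hsplit := FDRep.character_eq_add_of_splitting f r (Limits.kernel.ι r) q hr
      (by rw [← cancel_mono (Limits.kernel.ι r), Category.assoc, hq]; simp) (by rw [hq]; abel)
    have hdim : finrank ℂ V = finrank ℂ W + finrank ℂ (Limits.kernel r : FDRep ℂ K) := by
      have := hsplit 1
      simp only [FDRep.char_one] at this
      exact_mod_cast this
    have hW : 0 < finrank ℂ W := by
      refine Nat.pos_of_ne_zero fun hz => hf0 ?_
      have := Module.finrank_zero_iff.1 hz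
      ext x
      rw [Subsingleton.elim x 0]
      simp
    have hK : 0 < finrank ℂ (Limits.kernel r : FDRep ℂ K) := by
      refine Nat.pos_of_ne_zero fun hz => hfi ?_
      have := Module.finrank_zero_iff.1 hz
      have hz : Limits.kernel.ι r = 0 := by
        ext x
        rw [Subsingleton.elim x 0]
        simp
      refine ⟨r, hr, ?_⟩
      rw [hz, Limits.comp_zero] at hq
      exact (sub_eq_zero.1 hq.symm).symm
    obtain ⟨c, hc⟩ := ih _ (by omega) W rfl
    obtain ⟨d, hd⟩ := ih _ (by omega) (Limits.kernel r) rfl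
    refine ⟨c + d, fun g => ?_⟩
    rw [hsplit, hc, hd, ← Finset.sum_add_distrib]
    simp [add_mul]

theorem FDRep.inner_character {K ι : Type} [Group K] [Fintype K]
    (Irr : ι → FDRep ℂ K) (hsimple : ∀ i, Simple (Irr i))
    (hdistinct : ∀ i j, Nonempty (Irr i ≅ Irr j) → i = j) (i j : ι) :
    (Fintype.card K : ℂ)⁻¹ * ∑ g, conj ((Irr i).character g) * (Irr j).character g =
      if j = i then 1 else 0 := by
  have := hsimple i
  have := hsimple j
  have := invertibleOfNonzero (NeZero.ne (Nat.card K : ℂ))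
  have h := FDRep.char_orthonormal (Irr j) (Irr i)
  have hiff : Nonempty (Irr j ≅ Irr i) ↔ j = i :=
    ⟨hdistinct j i, fun h => h ▸ ⟨Iso.refl _⟩⟩
  simp only [hiff] at h
  rw [← h, Fintype.card_eq_nat_card]
  simp only [FDRep.conj_character, mul_comm]

theorem FDRep.character_eq_sum_inner {K ι : Type} [Group K] [Fintype K] [Fintype ι]
    (Irr : ι → FDRep ℂ K) (hsimple : ∀ i, Simple (Irr i))
    (hdistinct : ∀ i j, Nonempty (Irr i ≅ Irr j) → i = j)
    (hcomplete : ∀ V : FDRep ℂ K, Simple V → ∃ i, Nonempty (V ≅ Irr i)) (V : FDRep ℂ K) (g : K) :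
    V.character g = ∑ i, ((Fintype.card K : ℂ)⁻¹ *
      ∑ x, conj ((Irr i).character x) * V.character x) * (Irr i).character g := by
  obtain ⟨c, hc⟩ := FDRep.exists_character_eq_sum Irr hcomplete V
  rw [hc g]
  refine Finset.sum_congr rfl fun i _ => ?_
  congr 1
  have : ∀ x, conj ((Irr i).character x) * V.character x =
      ∑ j, c j * (conj ((Irr i).character x) * (Irr j).character x) := fun x => by
    rw [hc, Finset.mul_sum]
    exact Finset.sum_congr rfl fun j _ => by ring
  simp only [this]
  rw [Finset.sum_comm]
  simp only [← Finset.mul_sum]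
  rw [Finset.mul_sum]
  simp only [mul_left_comm _ (c _), FDRep.inner_character Irr hsimple hdistinct]
  simp

section Restriction

variable {G : Type} [Group G] (H : Subgroup G) [Fintype H]

theorem conj_kappa (τ : FDRep ℂ H) (ρ : FDRep ℂ G) [Fintype G] :
    conj (kappa H τ ρ) = kappa H τ ρ := by
  simp only [kappa, map_mul, map_sum, map_inv₀, map_natCast, FDRep.conj_character, inv_inv]
  congr 1
  rw [← Equiv.sum_comp (Equiv.inv H)]
  simp

theorem sum_kappa_mul_kappa {ιH : Type} [Fintype G] [Fintype ιH] (IrrH : ιH → FDRep ℂ H)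
    (hsimple : ∀ t, Simple (IrrH t))
    (hdistinct : ∀ t s, Nonempty (IrrH t ≅ IrrH s) → t = s)
    (hcomplete : ∀ W : FDRep ℂ H, Simple W → ∃ t, Nonempty (W ≅ IrrH t)) (V W : FDRep ℂ G) :
    ∑ t, kappa H (IrrH t) V * kappa H (IrrH t) W =
      (Fintype.card H : ℂ)⁻¹ * ∑ h : H, V.character (h : G) * conj (W.character (h : G)) := by
  have hexp : ∀ h : H, V.character (h : G) =
      ∑ t, kappa H (IrrH t) V * (IrrH t).character h := fun h =>
    FDRep.character_eq_sum_inner IrrH hsimple hdistinct hcomplete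
      (FDRep.of (V.ρ.comp H.subtype)) h
  simp only [hexp, Finset.sum_mul]
  rw [Finset.sum_comm, Finset.mul_sum]
  refine Finset.sum_congr rfl fun t _ => ?_
  rw [← conj_kappa H (IrrH t) W]
  conv_lhs => rw [kappa.eq_def H (IrrH t) W]
  simp only [map_mul, map_sum, map_inv₀, map_natCast, Complex.conj_conj, Finset.mul_sum]
  exact Finset.sum_congr rfl fun h _ => by ring

end Restriction

section Induction

variable {G : Type} [Group G] [Fintype G] (H : Subgroup G) [Fintype H]

/-- The character of `Ind_H^G 1`. -/
noncomputable def indTrivialCharacter (g : G) : ℂ :=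
  (Fintype.card H : ℂ)⁻¹ * (Finset.univ.filter fun t : G => t⁻¹ * g * t ∈ H).card

theorem card_conj_mem_eq (g : G) :
    (Finset.univ.filter fun t : G => t⁻¹ * g * t ∈ H).card =
      Fintype.card H * (Finset.univ.filter fun x : G ⧸ H => g • x = x).card := by
  have hfix : ∀ t : G, t⁻¹ * g * t ∈ H ↔ g • (t : G ⧸ H) = t := fun t => by
    rw [eq_comm, show g • (t : G ⧸ H) = ((g * t : G) : G ⧸ H) from rfl, QuotientGroup.eq, mul_assoc]
  rw [Finset.card_eq_sum_card_fiberwise (f := fun t : G => (t : G ⧸ H))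
    (t := Finset.univ.filter fun x : G ⧸ H => g • x = x)
    (fun t ht => by simpa [hfix] using ht), mul_comm, ← smul_eq_mul, ← Finset.sum_const]
  refine Finset.sum_congr rfl fun x hx => ?_
  obtain ⟨s, rfl⟩ := QuotientGroup.mk_surjective x
  rw [Fintype.card, eq_comm]
  refine Finset.card_bij (fun h _ => s * h) (fun h _ => ?_) (fun a _ b _ hab => ?_)
    fun t ht => ?_
  · have : ((s * h : G) : G ⧸ H) = s := QuotientGroup.mk_mul_of_mem s h.2
    simp only [Finset.mem_filter, Finset.mem_univ, true_and] at hx ⊢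
    rw [hfix, this]
    exact ⟨hx, rfl⟩
  · exact Subtype.ext (mul_left_cancel hab)
  · simp only [Finset.mem_filter, Finset.mem_univ, true_and] at ht
    exact ⟨⟨s⁻¹ * t, QuotientGroup.eq.1 ht.2.symm⟩, Finset.mem_univ _, by simp⟩

theorem exists_character_eq_indTrivialCharacter :
    ∃ P : FDRep ℂ G, P.character = indTrivialCharacter H := by
  refine ⟨FDRep.of (Representation.ofMulAction ℂ G (G ⧸ H)), funext fun g => ?_⟩
  change LinearMap.trace ℂ _ (Representation.ofMulAction ℂ G (G ⧸ H) g) = _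
  rw [LinearMap.trace_eq_matrix_trace ℂ (MonoidAlgebra.basis (G ⧸ H) ℂ), indTrivialCharacter,
    card_conj_mem_eq, Nat.cast_mul, inv_mul_cancel_left₀ (by simp)]
  simp only [Matrix.trace, Matrix.diag_apply, LinearMap.toMatrix_apply, MonoidAlgebra.basis_apply,
    Representation.ofMulAction_single]
  simp only [← MonoidAlgebra.basis_apply, Module.Basis.repr_self, Finsupp.single_apply]
  simp

theorem sum_mul_indTrivialCharacter (F : G → ℂ) (hF : ∀ g t, F (t * g * t⁻¹) = F g) :
    (Fintype.card G : ℂ)⁻¹ * ∑ g, F g * indTrivialCharacter H g =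
      (Fintype.card H : ℂ)⁻¹ * ∑ h : H, F h := by
  have hcard : (Fintype.card G : ℂ) ≠ 0 := by simp
  have hsub : ∑ h : H, F h = ∑ g, if g ∈ H then F g else 0 := by
    rw [← Finset.sum_filter]
    exact (Finset.sum_subtype _ (by simp) F).symm
  have hconj : ∀ t : G, (∑ g, if t⁻¹ * g * t ∈ H then F g else 0) = ∑ h : H, F h := fun t => by
    rw [hsub, ← (MulAut.conj t).toEquiv.sum_comp]
    refine Finset.sum_congr rfl fun g _ => ?_
    change (if t⁻¹ * (t * g * t⁻¹) * t ∈ H then F (t * g * t⁻¹) else 0) = _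
    rw [hF, show t⁻¹ * (t * g * t⁻¹) * t = g by group]
  have : ∑ g, F g * indTrivialCharacter H g =
      (Fintype.card H : ℂ)⁻¹ * ∑ t : G, ∑ g, if t⁻¹ * g * t ∈ H then F g else 0 := by
    rw [Finset.sum_comm, Finset.mul_sum]
    refine Finset.sum_congr rfl fun g _ => ?_
    rw [indTrivialCharacter, ← Finset.sum_filter, Finset.sum_const, nsmul_eq_mul]
    ring
  rw [this]
  simp only [hconj, Finset.sum_const, Finset.card_univ, nsmul_eq_mul]
  field_simp

end Induction

/-- The `r`-step transition probability of the chain `J` started at the trivial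
representation: `J^r_1(ρ) = dim(ρ)·(|H|/|G|)^r·⟨χ^ρ, (Ind_H^G 1)^r⟩`, where
`(Ind_H^G 1)(g) = |{t : t⁻¹gt ∈ H}|/|H|` is the character of `G` acting on cosets of `H`. -/
theorem stmt5 {G : Type} [Group G] [Fintype G] [Nontrivial G] (H : Subgroup G) [Fintype H]
    {ιG ιH : Type} [Fintype ιG] [Fintype ιH]
    (IrrG : ιG → FDRep ℂ G) (IrrH : ιH → FDRep ℂ H)
    (hGsimple : ∀ i, Simple (IrrG i))
    (hGdistinct : ∀ i j, Nonempty (IrrG i ≅ IrrG j) → i = j)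
    (hGcomplete : ∀ V : FDRep ℂ G, Simple V → ∃ i, Nonempty (V ≅ IrrG i))
    (hHsimple : ∀ t, Simple (IrrH t))
    (hHdistinct : ∀ t s, Nonempty (IrrH t ≅ IrrH s) → t = s)
    (hHcomplete : ∀ W : FDRep ℂ H, Simple W → ∃ t, Nonempty (W ≅ IrrH t))
    (J : Matrix ιG ιG ℂ)
    (hJ : ∀ i j, J i j =
      (Fintype.card H : ℂ) / (Fintype.card G : ℂ) *
        ((finrank ℂ (IrrG j) : ℂ) / (finrank ℂ (IrrG i) : ℂ)) *
        ∑ t : ιH, kappa H (IrrH t) (IrrG i) * kappa H (IrrH t) (IrrG j))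
    (i0 : ιG) (htriv : ∀ g : G, (IrrG i0).character g = 1)
    (r : ℕ) (i : ιG) :
    (J ^ r) i0 i =
      (finrank ℂ (IrrG i) : ℂ) * ((Fintype.card H : ℂ) / (Fintype.card G : ℂ)) ^ r *
        ((Fintype.card G : ℂ)⁻¹ * ∑ g : G, (starRingEnd ℂ) ((IrrG i).character g) *
          ((Fintype.card H : ℂ)⁻¹ *
            (Finset.univ.filter fun t : G => t⁻¹ * g * t ∈ H).card) ^ r) := by
  change _ = (finrank ℂ (IrrG i) : ℂ) * ((Fintype.card H : ℂ) / (Fintype.card G : ℂ)) ^ r *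
    ((Fintype.card G : ℂ)⁻¹ * ∑ g : G, conj ((IrrG i).character g) *
      indTrivialCharacter H g ^ r)
  obtain ⟨P, hP⟩ := exists_character_eq_indTrivialCharacter H
  have hpow : ∀ r, ∃ U : FDRep ℂ G, ∀ g, U.character g = indTrivialCharacter H g ^ r := by
    intro r
    induction r with
    | zero => exact ⟨IrrG i0, by simpa using htriv⟩
    | succ r ih =>
      obtain ⟨U, hU⟩ := ih
      refine ⟨MonoidalCategory.tensorObj U P, fun g => ?_⟩
      rw [FDRep.char_tensor, Pi.mul_apply, hU, hP, pow_succ]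
  have hdim : ∀ k, (finrank ℂ (IrrG k) : ℂ) ≠ 0 := fun k hk => by
    have hz : finrank ℂ (IrrG k) = 0 := by exact_mod_cast hk
    have := Module.finrank_zero_iff.1 hz
    have := hGsimple k
    refine id_nonzero (IrrG k) ?_
    ext x
    exact Subsingleton.elim _ _
  induction r generalizing i with
  | zero =>
    have h := FDRep.inner_character IrrG hGsimple hGdistinct i i0
    simp only [htriv] at h
    simp only [pow_zero, Matrix.one_apply, h]
    split_ifs with hi
    · subst hi
      have := htriv 1
      rw [FDRep.char_one] at this
      simp [this]
    · simp
  | succ r ih =>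
    obtain ⟨U, hU⟩ := hpow r
    have hexp := FDRep.character_eq_sum_inner IrrG hGsimple hGdistinct hGcomplete U
    simp only [hU] at hexp
    have hind := sum_mul_indTrivialCharacter H
      (fun g => conj ((IrrG i).character g) * U.character g) fun g t => by
        simp only [FDRep.char_conj]
    simp only [hU, mul_assoc, ← pow_succ] at hind
    rw [hind, pow_succ J, Matrix.mul_apply]
    have hterm : ∀ k, (J ^ r) i0 k * J k i = (finrank ℂ (IrrG i) : ℂ) *
        ((Fintype.card H : ℂ) / (Fintype.card G : ℂ)) ^ (r + 1) * ((Fintype.card H : ℂ)⁻¹ *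
          ∑ h : H, conj ((IrrG i).character h) * (((Fintype.card G : ℂ)⁻¹ *
            ∑ g : G, conj ((IrrG k).character g) * indTrivialCharacter H g ^ r) *
              (IrrG k).character h)) := fun k => by
      have hs : ∑ h : H, conj ((IrrG i).character h) * (((Fintype.card G : ℂ)⁻¹ *
            ∑ g : G, conj ((IrrG k).character g) * indTrivialCharacter H g ^ r) *
              (IrrG k).character h) = ((Fintype.card G : ℂ)⁻¹ *
            ∑ g : G, conj ((IrrG k).character g) * indTrivialCharacter H g ^ r) *
          ∑ h : H, (IrrG k).character h * conj ((IrrG i).character h) := by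
        rw [Finset.mul_sum (s := Finset.univ (α := H))]
        exact Finset.sum_congr rfl fun h _ => by ring
      rw [ih, hJ, sum_kappa_mul_kappa H IrrH hHsimple hHdistinct hHcomplete, hs, pow_succ]
      have := hdim k
      field_simp
    simp only [hterm, ← Finset.mul_sum]
    rw [Finset.sum_comm]
    simp only [← Finset.mul_sum, ← hexp]
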